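/- Let k ∈ ℂ with Re(k) > 0 and δ > 0. Let f : ℚ → ℂ satisfy weak periodicity (f(x+1) = f(x) for all x ∈ ℚ\[−1,0]) and the reciprocity relation f(x) − |x|^{−k}·f(−1/x) = h(x) for all x ∈ ℚ\{0}, where h : ℝ\{0} → ℂ satisfies |h(x)| ≤ C·exp(|x|^{−1+δ}) for all x ∈ (−1,1)\{0} and some C > 0. Then there is a set X ⊆ ℝ of full Lebesgue measure such that for every x ∈ X the limit f‡(x) := lim_{j→∞} den(x_{2j+1})^{−k}·f( (x_{2j+1})‾ ) exists, where x_{2j+1} denotes the (2j+1)-st continued-fraction convergent of x and (x_{2j+1})‾ is obtained by replacing the numerator of x_{2j+1} by its multiplicative inverse modulo the denominator. The resulting function f‡ is Lebesgue-measurable. -/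

import Mathlib

open Filter Topology MeasureTheory Set

/-- Partial quotients of the regular continued fraction expansion of `x`
(with the convention that `cfb j x = 0` for `j` beyond the length of the expansion). -/
noncomputable def cfb : ℕ → ℝ → ℤ
  | 0, x => ⌊x⌋
  | n + 1, x => cfb n (Int.fract x)⁻¹

/-- Numerators and denominators of the continued fraction convergents of `x`. -/
noncomputable def cfPQ (x : ℝ) : ℕ → ℤ × ℤ
  | 0 => (cfb 0 x, 1)
  | 1 => (cfb 1 x * cfb 0 x + 1, cfb 1 x)
  | n + 2 => (cfb (n + 2) x * (cfPQ x (n + 1)).1 + (cfPQ x n).1,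
              cfb (n + 2) x * (cfPQ x (n + 1)).2 + (cfPQ x n).2)

/-- The `n`-th continued fraction convergent of `x`, as a rational number. -/
noncomputable def cfConv (x : ℝ) (n : ℕ) : ℚ := ((cfPQ x n).1 : ℚ) / ((cfPQ x n).2 : ℚ)

/-- For a rational `y = a/q` in lowest terms, `ratBar y = ā/q` where `ā ∈ {1,…,q}` is
the multiplicative inverse of `a` modulo `q` (and `ā = 1` when `q = 1`). -/
def ratBar (y : ℚ) : ℚ :=
  (if ((y.num : ZMod y.den)⁻¹).val = 0 then (y.den : ℚ)
   else (((y.num : ZMod y.den)⁻¹).val : ℚ)) / (y.den : ℚ)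

theorem measurable_cfb (n : ℕ) : Measurable (cfb n) := by
  induction n with
  | zero => exact Int.measurable_floor
  | succ n ih => exact ih.comp measurable_fract.inv

theorem measurable_cfPQ (n : ℕ) : Measurable (fun x => cfPQ x n) := by
  induction n using Nat.twoStepInduction with
  | zero => exact (measurable_cfb 0).prodMk measurable_const
  | one =>
    exact (((measurable_cfb 1).mul (measurable_cfb 0)).add_const 1).prodMk (measurable_cfb 1)
  | more n ih₀ ih₁ =>
    exact (((measurable_cfb (n + 2)).mul ih₁.fst).add ih₀.fst).prodMk
      (((measurable_cfb (n + 2)).mul ih₁.snd).add ih₀.snd)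

theorem cfb_eq_floor_iterate (n : ℕ) (x : ℝ) :
    cfb n x = ⌊(fun y : ℝ => (Int.fract y)⁻¹)^[n] x⌋ := by
  induction n generalizing x with
  | zero => rfl
  | succ n ih => exact ih _

theorem sum_range_log_gauss_le {a b : ℝ} (ha : 0 ≤ a) (hab : a ≤ b) (N : ℕ) :
    ∑ i ∈ Finset.range N,
      (Real.log (1 + ((i : ℝ) + 1 + a)⁻¹) - Real.log (1 + ((i : ℝ) + 1 + b)⁻¹))
      ≤ Real.log (1 + b) - Real.log (1 + a) := by
  have hsplit : ∀ (i : ℕ) (c : ℝ), 0 ≤ c → Real.log (1 + ((i : ℝ) + 1 + c)⁻¹)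
      = Real.log (((i + 1 : ℕ) : ℝ) + 1 + c) - Real.log ((i : ℝ) + 1 + c) := by
    intro i c hc
    rw [← Real.log_div (by positivity) (by positivity)]
    congr 1
    push_cast
    field_simp
    ring
  have key : ∑ i ∈ Finset.range N,
      (Real.log (1 + ((i : ℝ) + 1 + a)⁻¹) - Real.log (1 + ((i : ℝ) + 1 + b)⁻¹))
      = (Real.log ((N : ℝ) + 1 + a) - Real.log ((N : ℝ) + 1 + b))
        - (Real.log (((0 : ℕ) : ℝ) + 1 + a) - Real.log (((0 : ℕ) : ℝ) + 1 + b)) := by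
    rw [← Finset.sum_range_sub (fun i : ℕ =>
      Real.log ((i : ℝ) + 1 + a) - Real.log ((i : ℝ) + 1 + b))]
    refine Finset.sum_congr rfl fun i _ => ?_
    rw [hsplit i a ha, hsplit i b (ha.trans hab)]
    ring
  rw [key]
  have : Real.log ((N : ℝ) + 1 + a) ≤ Real.log ((N : ℝ) + 1 + b) :=
    Real.log_le_log (by positivity) (by linarith)
  simp only [Nat.cast_zero, zero_add]
  linarith

/-- The law of the fractional part of the `n`-th complete quotient is dominated by (twice) the
Gauss measure. -/
theorem volume_fract_iterate_le (m : ℤ) (n : ℕ) {a b : ℝ} (ha : 0 ≤ a) (hab : a ≤ b)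
    (hb : b ≤ 1) :
    volume {x : ℝ | ⌊x⌋ = m ∧
        Int.fract ((fun y : ℝ => (Int.fract y)⁻¹)^[n] x) ∈ Ioo a b}
      ≤ ENNReal.ofReal (2 * (Real.log (1 + b) - Real.log (1 + a))) := by
  induction n generalizing a b with
  | zero =>
    have hb0 : 0 ≤ b := ha.trans hab
    have hsub : {x : ℝ | ⌊x⌋ = m ∧
        Int.fract ((fun y : ℝ => (Int.fract y)⁻¹)^[0] x) ∈ Ioo a b} ⊆ Ioo (m + a) (m + b) := by
      rintro x ⟨hx, hxa, hxb⟩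
      simp only [Function.iterate_zero, id, Int.fract, hx] at hxa hxb
      exact ⟨by linarith, by linarith⟩
    refine (measure_mono hsub).trans ?_
    rw [Real.volume_Ioo]
    refine ENNReal.ofReal_le_ofReal ?_
    have hlog := Real.log_le_sub_one_of_pos (x := (1 + a) / (1 + b)) (by positivity)
    rw [Real.log_div (by positivity) (by positivity), div_sub_one (by positivity)] at hlog
    have : (b - a) / 2 ≤ (b - a) / (1 + b) :=
      div_le_div_of_nonneg_left (by linarith) (by linarith) (by linarith)
    have h2 : (1 + a - (1 + b)) / (1 + b) = -((b - a) / (1 + b)) := by ring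
    linarith
  | succ n ih =>
    have hb0 : 0 ≤ b := ha.trans hab
    have hsub : {x : ℝ | ⌊x⌋ = m ∧
        Int.fract ((fun y : ℝ => (Int.fract y)⁻¹)^[n + 1] x) ∈ Ioo a b} ⊆
        ⋃ i : ℕ, {x : ℝ | ⌊x⌋ = m ∧ Int.fract ((fun y : ℝ => (Int.fract y)⁻¹)^[n] x) ∈
          Ioo ((i : ℝ) + 1 + b)⁻¹ ((i : ℝ) + 1 + a)⁻¹} := by
      rintro x ⟨hx, hxab⟩
      rw [Function.iterate_succ_apply'] at hxab
      set t := Int.fract ((fun y : ℝ => (Int.fract y)⁻¹)^[n] x) with ht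
      have ht0 : 0 < t := by
        refine lt_of_le_of_ne (Int.fract_nonneg _) fun h0 => ?_
        rw [← h0] at hxab
        simp only [inv_zero, Int.fract_zero] at hxab
        exact absurd hxab.1 (not_lt.2 ha)
      have ht1 : t < 1 := Int.fract_lt_one _
      have hfl : 1 ≤ ⌊t⁻¹⌋ := by
        rw [Int.le_floor]
        exact_mod_cast (one_le_inv₀ ht0).2 ht1.le
      obtain ⟨i, hi⟩ := Int.eq_ofNat_of_zero_le (sub_nonneg.2 hfl)
      have hi' : (⌊t⁻¹⌋ : ℝ) = i + 1 := by
        have : ⌊t⁻¹⌋ = (i : ℤ) + 1 := by omega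
        rw [this]; push_cast; rfl
      have hfr : t⁻¹ = i + 1 + Int.fract t⁻¹ := by rw [← hi']; exact (Int.floor_add_fract _).symm
      refine mem_iUnion.2 ⟨i, hx, ?_, ?_⟩
      · rw [inv_lt_comm₀ (by positivity) ht0]
        linarith [hxab.2]
      · rw [lt_inv_comm₀ ht0 (by positivity)]
        linarith [hxab.1]
    refine (measure_mono hsub).trans ((measure_iUnion_le _).trans ?_)
    have hmono : ∀ i : ℕ, ((i : ℝ) + 1 + b)⁻¹ ≤ ((i : ℝ) + 1 + a)⁻¹ := fun i =>
      inv_anti₀ (by positivity) (by linarith)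
    have hle : ∀ i : ℕ, _ := fun i : ℕ => ih (a := ((i : ℝ) + 1 + b)⁻¹)
      (b := ((i : ℝ) + 1 + a)⁻¹) (by positivity) (hmono i)
      (inv_le_one_of_one_le₀ (by linarith [(Nat.cast_nonneg i : (0 : ℝ) ≤ i)]))
    refine (ENNReal.tsum_le_tsum hle).trans (ENNReal.tsum_le_of_sum_range_le fun N => ?_)
    rw [← ENNReal.ofReal_sum_of_nonneg]
    · refine ENNReal.ofReal_le_ofReal ?_
      rw [← Finset.mul_sum]
      exact mul_le_mul_of_nonneg_left (sum_range_log_gauss_le ha hab N) zero_le_two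
    · intro i _
      have : Real.log (1 + ((i : ℝ) + 1 + b)⁻¹) ≤ Real.log (1 + ((i : ℝ) + 1 + a)⁻¹) :=
        Real.log_le_log (by positivity) (by linarith [hmono i])
      linarith

/-- The easy half of the Borel–Bernstein theorem: almost every real number has partial quotients
of size `O(n ^ A)`, for every `A > 1`. -/
theorem ae_eventually_cfb_le {A : ℝ} (hA : 1 < A) :
    ∀ᵐ x : ℝ, ∀ᶠ n : ℕ in atTop, (cfb n x : ℝ) ≤ (n : ℝ) ^ A := by
  have hm : ∀ m : ℤ, ∀ᵐ x : ℝ, ∀ᶠ n : ℕ in atTop, ¬ (⌊x⌋ = m ∧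
      Int.fract ((fun y : ℝ => (Int.fract y)⁻¹)^[n] x) ∈ Ioo 0 (((n : ℝ) + 1) ^ A)⁻¹) := by
    intro m
    refine ae_eventually_notMem (s := fun n : ℕ => {x : ℝ | ⌊x⌋ = m ∧
      Int.fract ((fun y : ℝ => (Int.fract y)⁻¹)^[n] x) ∈ Ioo 0 (((n : ℝ) + 1) ^ A)⁻¹}) ?_
    have hs : Summable fun n : ℕ => 2 * (((n : ℝ) + 1) ^ A)⁻¹ := by
      have := ((summable_nat_add_iff 1).2 (Real.summable_nat_rpow_inv.2 hA)).mul_left 2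
      simpa using this
    refine ne_top_of_le_ne_top hs.tsum_ofReal_ne_top (ENNReal.tsum_le_tsum fun n => ?_)
    refine (volume_fract_iterate_le m n le_rfl (by positivity)
      (inv_le_one_of_one_le₀ (Real.one_le_rpow (by simp) (by linarith)))).trans ?_
    refine ENNReal.ofReal_le_ofReal ?_
    have := Real.log_le_sub_one_of_pos (x := 1 + (((n : ℝ) + 1) ^ A)⁻¹) (by positivity)
    rw [add_zero, Real.log_one]
    linarith
  filter_upwards [ae_all_iff.2 hm] with x hx
  suffices ∀ᶠ n : ℕ in map (· + 1) atTop, (cfb n x : ℝ) ≤ (n : ℝ) ^ A by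
    rwa [map_add_atTop_eq_nat] at this
  rw [eventually_map]
  filter_upwards [hx ⌊x⌋] with n hn
  rw [cfb_eq_floor_iterate, Function.iterate_succ_apply']
  set t := Int.fract ((fun y : ℝ => (Int.fract y)⁻¹)^[n] x) with ht
  refine (Int.floor_le _).trans ?_
  push_cast
  by_contra! hlt
  refine hn ⟨rfl, ?_⟩
  have hpos : (0 : ℝ) < ((n : ℝ) + 1) ^ A := by positivity
  have ht0 : 0 < t := inv_pos.1 (hpos.trans hlt)
  exact ⟨ht0, (lt_inv_comm₀ hpos ht0).1 hlt⟩

theorem one_le_cfb_succ {x : ℝ} (hx : Irrational x) (n : ℕ) : 1 ≤ cfb (n + 1) x := by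
  induction n generalizing x with
  | zero =>
    have hpos : 0 < Int.fract x :=
      lt_of_le_of_ne (Int.fract_nonneg x) fun h0 => hx ⟨⌊x⌋, by
        rw [Int.fract] at h0
        push_cast
        linarith⟩
    change 1 ≤ ⌊(Int.fract x)⁻¹⌋
    rw [Int.le_floor]
    exact_mod_cast (one_le_inv₀ hpos).2 (Int.fract_lt_one x).le
  | succ n ih => exact ih (hx.sub_intCast ⌊x⌋).inv

theorem cfPQ_det (x : ℝ) (n : ℕ) :
    (cfPQ x (n + 1)).1 * (cfPQ x n).2 - (cfPQ x n).1 * (cfPQ x (n + 1)).2 = (-1) ^ n := by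
  induction n with
  | zero => simp [cfPQ]; ring
  | succ n ih =>
    simp only [cfPQ]
    rw [pow_succ, ← ih]
    ring

theorem cfPQ_snd_succ_succ (x : ℝ) (n : ℕ) :
    (cfPQ x (n + 2)).2 = cfb (n + 2) x * (cfPQ x (n + 1)).2 + (cfPQ x n).2 := rfl

theorem one_le_cfPQ_snd {x : ℝ} (hx : Irrational x) (n : ℕ) : 1 ≤ (cfPQ x n).2 := by
  induction n using Nat.twoStepInduction with
  | zero => exact le_rfl
  | one => exact one_le_cfb_succ hx 0
  | more n ih₀ ih₁ =>
    rw [cfPQ_snd_succ_succ]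
    nlinarith [one_le_cfb_succ hx (n + 1)]

theorem cfPQ_snd_add_le {x : ℝ} (hx : Irrational x) (n : ℕ) :
    (cfPQ x (n + 1)).2 + (cfPQ x n).2 ≤ (cfPQ x (n + 2)).2 := by
  rw [cfPQ_snd_succ_succ]
  nlinarith [one_le_cfb_succ hx (n + 1), one_le_cfPQ_snd hx (n + 1)]

theorem cfPQ_snd_lt {x : ℝ} (hx : Irrational x) (n : ℕ) :
    (cfPQ x (n + 1)).2 < (cfPQ x (n + 2)).2 := by
  linarith [cfPQ_snd_add_le hx n, one_le_cfPQ_snd hx n]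

theorem cfPQ_snd_mono {x : ℝ} (hx : Irrational x) (n : ℕ) :
    (cfPQ x n).2 ≤ (cfPQ x (n + 1)).2 := by
  cases n with
  | zero => exact one_le_cfPQ_snd hx 1
  | succ n => exact (cfPQ_snd_lt hx n).le

theorem pow_le_cfPQ_snd {x : ℝ} (hx : Irrational x) (n : ℕ) :
    (3 / 2 : ℝ) ^ n ≤ 3 / 2 * (cfPQ x n).2 := by
  induction n using Nat.twoStepInduction with
  | zero => norm_num [cfPQ]
  | one =>
    have : (1 : ℝ) ≤ (cfPQ x 1).2 := mod_cast one_le_cfPQ_snd hx 1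
    linarith
  | more n ih₀ ih₁ =>
    have : ((cfPQ x (n + 1)).2 : ℝ) + (cfPQ x n).2 ≤ (cfPQ x (n + 2)).2 :=
      mod_cast cfPQ_snd_add_le hx n
    have hpos : (0 : ℝ) < (3 / 2) ^ n := by positivity
    rw [pow_succ] at ih₁ ⊢
    rw [pow_succ]
    linarith

theorem isCoprime_cfPQ (x : ℝ) (n : ℕ) :
    IsCoprime (cfPQ x (n + 1)).1 (cfPQ x (n + 1)).2 := by
  refine ⟨(-1) ^ n * (cfPQ x n).2, -(-1) ^ n * (cfPQ x n).1, ?_⟩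
  have h1 : ((-1 : ℤ) ^ n) * (-1) ^ n = 1 := by rw [← mul_pow]; simp
  linear_combination (-1) ^ n * cfPQ_det x n + h1

theorem cfConv_den {x : ℝ} (hx : Irrational x) (n : ℕ) :
    ((cfConv x (n + 1)).den : ℤ) = (cfPQ x (n + 1)).2 :=
  Rat.den_div_eq_of_coprime (one_le_cfPQ_snd hx _)
    (Int.isCoprime_iff_gcd_eq_one.1 (isCoprime_cfPQ x n))

theorem cfConv_num {x : ℝ} (hx : Irrational x) (n : ℕ) :
    (cfConv x (n + 1)).num = (cfPQ x (n + 1)).1 :=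
  Rat.num_div_eq_of_coprime (one_le_cfPQ_snd hx _)
    (Int.isCoprime_iff_gcd_eq_one.1 (isCoprime_cfPQ x n))

theorem ratBar_eq {y : ℚ} {b : ℤ} (hb0 : 0 < b) (hb : b < y.den)
    (hinv : (y.den : ℤ) ∣ y.num * b - 1) : ratBar y = b / y.den := by
  lift b to ℕ using hb0.le
  have hval : ((y.num : ZMod y.den)⁻¹).val = b := by
    have : (y.num : ZMod y.den) * (b : ZMod y.den) = 1 := by
      rw [← sub_eq_zero]
      exact_mod_cast (ZMod.intCast_zmod_eq_zero_iff_dvd _ _).2 hinv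
    rw [ZMod.inv_eq_of_mul_eq_one _ _ _ this, ZMod.val_natCast_of_lt (mod_cast hb)]
  rw [ratBar, hval, if_neg (by omega)]
  rfl

/-- Numerator inversion turns the convergent `p_n / q_n` of odd index into `q_{n-1} / q_n`. -/
theorem ratBar_cfConv {x : ℝ} (hx : Irrational x) {n : ℕ} (hn : Even n) (hn0 : n ≠ 0) :
    ratBar (cfConv x (n + 1)) = (cfPQ x n).2 / (cfPQ x (n + 1)).2 := by
  have hlt : (cfPQ x n).2 < (cfPQ x (n + 1)).2 := by
    obtain ⟨m, rfl⟩ := Nat.exists_eq_succ_of_ne_zero hn0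
    exact cfPQ_snd_lt hx m
  have hden := cfConv_den hx n
  rw [ratBar_eq (one_le_cfPQ_snd hx n) (hden ▸ hlt)]
  · rw [← hden]; rfl
  · rw [hden, cfConv_num hx]
    refine ⟨(cfPQ x n).1, ?_⟩
    linear_combination (cfPQ_det x n).trans hn.neg_one_pow

section Reciprocity

variable {f : ℚ → ℂ}

theorem apply_add_nat_of_weakly_periodic
    (hper : ∀ x : ℚ, x ∉ Set.Icc (-1 : ℚ) 0 → f (x + 1) = f x) {r : ℚ} (hr : 0 < r) (m : ℕ) :
    f (r + m) = f r := by
  induction m with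
  | zero => simp
  | succ m ih =>
    rw [Nat.cast_succ, ← add_assoc, hper _ fun hm => ?_, ih]
    have : (0 : ℚ) ≤ m := m.cast_nonneg
    linarith [hm.2]

theorem apply_neg_sub_nat_of_weakly_periodic
    (hper : ∀ x : ℚ, x ∉ Set.Icc (-1 : ℚ) 0 → f (x + 1) = f x) {r : ℚ} (hr : 0 < r) (m : ℕ) :
    f (-(r + m)) = f (-r) := by
  induction m with
  | zero => simp
  | succ m ih =>
    rw [← ih, ← hper (-(r + (m + 1 : ℕ))) fun hm => ?_]
    · congr 1; push_cast; ring
    · have h0 : (0 : ℚ) ≤ m := m.cast_nonneg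
      have := hm.1
      push_cast at this
      linarith

theorem cpow_neg_mul_cpow_neg_div (k : ℂ) {p q : ℝ} (hp : 0 < p) (hq : 0 < q) :
    (q : ℂ) ^ (-k) * ((p / q : ℝ) : ℂ) ^ (-k) = (p : ℂ) ^ (-k) := by
  rw [← Complex.mul_cpow_ofReal_nonneg hq.le (by positivity), ← Complex.ofReal_mul,
    mul_div_cancel₀ _ hq.ne']

variable {k : ℂ} {h : ℝ → ℂ}

/-- One step of the Euclidean algorithm, at a positive argument. -/
theorem cpow_mul_apply_div
    (hper : ∀ x : ℚ, x ∉ Set.Icc (-1 : ℚ) 0 → f (x + 1) = f x)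
    (hrec : ∀ x : ℚ, x ≠ 0 →
      f x - ((|((x : ℚ) : ℝ)| : ℝ) : ℂ) ^ (-k) * f (-1 / x) = h x)
    {p q r b : ℤ} (hp : 0 < p) (hr : 0 < r) (hb : 0 ≤ b) (hq : q = b * p + r) :
    ((q : ℝ) : ℂ) ^ (-k) * f (p / q) =
      ((p : ℝ) : ℂ) ^ (-k) * f (-(r / p)) + ((q : ℝ) : ℂ) ^ (-k) * h (p / q) := by
  have hq0 : 0 < q := by rw [hq]; positivity
  lift b to ℕ using hb
  have hp' : (0 : ℚ) < p := mod_cast hp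
  have hq' : (0 : ℚ) < q := mod_cast hq0
  have hr' : (0 : ℚ) < r := mod_cast hr
  have hpR : (0 : ℝ) < p := mod_cast hp
  have hqR : (0 : ℝ) < q := mod_cast hq0
  have harg : (-1 / ((p : ℚ) / q)) = -((r : ℚ) / p + b) := by
    rw [hq]; push_cast; field_simp; ring
  have := hrec (p / q) (by positivity)
  rw [harg, apply_neg_sub_nat_of_weakly_periodic hper (by positivity)] at this
  push_cast at this
  rw [abs_of_pos (by positivity)] at this
  rw [← cpow_neg_mul_cpow_neg_div k hpR hqR]
  linear_combination ((q : ℝ) : ℂ) ^ (-k) * this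

/-- One step of the Euclidean algorithm, at a negative argument. -/
theorem cpow_mul_apply_neg_div
    (hper : ∀ x : ℚ, x ∉ Set.Icc (-1 : ℚ) 0 → f (x + 1) = f x)
    (hrec : ∀ x : ℚ, x ≠ 0 →
      f x - ((|((x : ℚ) : ℝ)| : ℝ) : ℂ) ^ (-k) * f (-1 / x) = h x)
    {p q r b : ℤ} (hp : 0 < p) (hr : 0 < r) (hb : 0 ≤ b) (hq : q = b * p + r) :
    ((q : ℝ) : ℂ) ^ (-k) * f (-(p / q)) =
      ((p : ℝ) : ℂ) ^ (-k) * f (r / p) + ((q : ℝ) : ℂ) ^ (-k) * h (-(p / q)) := by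
  have hq0 : 0 < q := by rw [hq]; positivity
  lift b to ℕ using hb
  have hp' : (0 : ℚ) < p := mod_cast hp
  have hq' : (0 : ℚ) < q := mod_cast hq0
  have hr' : (0 : ℚ) < r := mod_cast hr
  have hpR : (0 : ℝ) < p := mod_cast hp
  have hqR : (0 : ℝ) < q := mod_cast hq0
  have harg : (-1 / (-((p : ℚ) / q))) = (r : ℚ) / p + b := by
    rw [hq]; push_cast; field_simp; ring
  have := hrec (-(p / q)) (neg_ne_zero.2 (by positivity))
  rw [harg, apply_add_nat_of_weakly_periodic hper (by positivity)] at this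
  push_cast at this
  rw [abs_neg, abs_of_pos (by positivity)] at this
  rw [← cpow_neg_mul_cpow_neg_div k hpR hqR]
  linear_combination ((q : ℝ) : ℂ) ^ (-k) * this

end Reciprocity

theorem eventually_nat_succ_rpow_le {s ε : ℝ} (hs : s < 1) (hε : 0 < ε) :
    ∀ᶠ n : ℕ in atTop, ((n : ℝ) + 1) ^ s ≤ ε * (n + 1) := by
  have h1 : Tendsto (fun n : ℕ => (n : ℝ) + 1) atTop atTop :=
    tendsto_atTop_add_const_right _ _ tendsto_natCast_atTop_atTop
  have h2 := (tendsto_rpow_neg_atTop (sub_pos.2 hs)).comp h1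
  filter_upwards [h2.eventually (gt_mem_nhds hε)] with n hn
  have hpos : (0 : ℝ) < n + 1 := by positivity
  have : ((n : ℝ) + 1) ^ s = ((n : ℝ) + 1) ^ (-(1 - s)) * (n + 1) := by
    rw [← Real.rpow_add_one hpos.ne']
    congr 1
    ring
  rw [this]
  exact mul_le_mul_of_nonneg_right hn.le hpos.le

theorem summable_cfPQ_rpow_mul_exp {x : ℝ} (hx : Irrational x) {A c δ : ℝ}
    (hxA : ∀ᶠ n : ℕ in atTop, (cfb n x : ℝ) ≤ (n : ℝ) ^ A) (hA : 0 ≤ A) (hc : 0 < c)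
    (hAδ : A * max (1 - δ) (1 / 2) < 1) :
    Summable fun n : ℕ => ((cfPQ x (n + 2)).2 : ℝ) ^ (-c) *
      Real.exp ((((cfPQ x (n + 1)).2 : ℝ) / (cfPQ x (n + 2)).2) ^ (-1 + δ)) := by
  set θ := max (1 - δ) (1 / 2) with hθ
  have hθ0 : 0 ≤ θ := le_max_of_le_right (by norm_num)
  set a := c * Real.log (3 / 2) with ha
  have ha0 : 0 < a := mul_pos hc (Real.log_pos (by norm_num))
  have hgeom : Summable fun n : ℕ => Real.exp (2 * a) * Real.exp ((n + 2 : ℕ) * (-(a / 2))) :=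
    ((summable_nat_add_iff 2).2 (Real.summable_exp_nat_mul_iff.2
      (neg_neg_of_pos (half_pos ha0)))).mul_left _
  refine summable_of_isBigO_nat hgeom (Asymptotics.IsBigO.of_bound 1 ?_)
  have hε : 0 < a / 2 / 2 ^ θ := by positivity
  filter_upwards [(tendsto_add_atTop_nat 2).eventually hxA,
    (tendsto_add_atTop_nat 1).eventually (eventually_nat_succ_rpow_le hAδ hε)] with n hb hs
  have hq : ∀ m, (1 : ℝ) ≤ (cfPQ x m).2 := fun m => mod_cast one_le_cfPQ_snd hx m
  have hq1 := hq (n + 1)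
  have hq2 := hq (n + 2)
  have hq12 : ((cfPQ x (n + 1)).2 : ℝ) ≤ (cfPQ x (n + 2)).2 := mod_cast cfPQ_snd_mono hx (n + 1)
  rw [one_mul, Real.norm_of_nonneg (by positivity), Real.norm_of_nonneg (by positivity)]
  have hexp : (((cfPQ x (n + 1)).2 : ℝ) / (cfPQ x (n + 2)).2) ^ (-1 + δ)
      ≤ a / 2 * ((n : ℝ) + 2) := by
    have hquot : ((cfPQ x (n + 2)).2 : ℝ) / (cfPQ x (n + 1)).2 ≤ 2 * ((n : ℝ) + 2) ^ A := by
      have hrecq : ((cfPQ x (n + 2)).2 : ℝ)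
          = cfb (n + 2) x * (cfPQ x (n + 1)).2 + (cfPQ x n).2 := mod_cast cfPQ_snd_succ_succ x n
      have hmono : ((cfPQ x n).2 : ℝ) ≤ (cfPQ x (n + 1)).2 := mod_cast cfPQ_snd_mono hx n
      have h1 : (1 : ℝ) ≤ ((n : ℝ) + 2) ^ A :=
        Real.one_le_rpow (by linarith [(Nat.cast_nonneg n : (0 : ℝ) ≤ n)]) hA
      push_cast at hb
      rw [div_le_iff₀ (by linarith), hrecq]
      nlinarith
    calc (((cfPQ x (n + 1)).2 : ℝ) / (cfPQ x (n + 2)).2) ^ (-1 + δ)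
        = (((cfPQ x (n + 2)).2 : ℝ) / (cfPQ x (n + 1)).2) ^ (1 - δ) := by
          rw [← inv_div, Real.inv_rpow (by positivity), ← Real.rpow_neg (by positivity)]
          congr 1
          ring
      _ ≤ (((cfPQ x (n + 2)).2 : ℝ) / (cfPQ x (n + 1)).2) ^ θ :=
          Real.rpow_le_rpow_of_exponent_le ((one_le_div (by linarith)).2 hq12) (le_max_left _ _)
      _ ≤ (2 * ((n : ℝ) + 2) ^ A) ^ θ := Real.rpow_le_rpow (by positivity) hquot hθ0
      _ = 2 ^ θ * ((n : ℝ) + 2) ^ (A * θ) := by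
          rw [Real.mul_rpow (by positivity) (by positivity), ← Real.rpow_mul (by positivity)]
      _ ≤ 2 ^ θ * (a / 2 / 2 ^ θ * ((n : ℝ) + 2)) := by
          refine mul_le_mul_of_nonneg_left ?_ (by positivity)
          push_cast at hs
          rwa [add_assoc, one_add_one_eq_two] at hs
      _ = a / 2 * ((n : ℝ) + 2) := by field_simp
  have hden : ((cfPQ x (n + 2)).2 : ℝ) ^ (-c) ≤ Real.exp (2 * a - a * (n + 2)) := by
    rw [Real.rpow_def_of_pos (by linarith)]
    refine Real.exp_le_exp.2 ?_
    have hl := Real.log_le_log (by positivity) (pow_le_cfPQ_snd hx (n + 2))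
    rw [Real.log_mul (by norm_num) (by positivity), Real.log_pow] at hl
    push_cast at hl
    have hl0 : 0 < Real.log (3 / 2) := Real.log_pos (by norm_num)
    rw [ha]
    nlinarith [mul_le_mul_of_nonneg_left hl hc.le]
  calc _ ≤ Real.exp (2 * a - a * (n + 2)) * Real.exp (a / 2 * ((n : ℝ) + 2)) := by gcongr
    _ = _ := by
      rw [← Real.exp_add, ← Real.exp_add]
      congr 1
      push_cast
      ring

theorem exists_tendsto_of_summable {k : ℂ} {δ C : ℝ} {f : ℚ → ℂ} {h : ℝ → ℂ}
    (hper : ∀ x : ℚ, x ∉ Set.Icc (-1 : ℚ) 0 → f (x + 1) = f x)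
    (hrec : ∀ x : ℚ, x ≠ 0 →
      f x - ((|((x : ℚ) : ℝ)| : ℝ) : ℂ) ^ (-k) * f (-1 / x) = h x)
    (hbound : ∀ x : ℝ, x ∈ Set.Ioo (-1 : ℝ) 1 → x ≠ 0 →
      ‖h x‖ ≤ C * Real.exp (|x| ^ (-1 + δ)))
    {x : ℝ} (hx : Irrational x)
    (hsum : Summable fun n : ℕ => ((cfPQ x (n + 2)).2 : ℝ) ^ (-k.re) *
      Real.exp ((((cfPQ x (n + 1)).2 : ℝ) / (cfPQ x (n + 2)).2) ^ (-1 + δ))) :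
    ∃ l : ℂ, Tendsto (fun j : ℕ => (((cfConv x (2 * j + 1)).den : ℝ) : ℂ) ^ (-k)
      * f (ratBar (cfConv x (2 * j + 1)))) atTop (𝓝 l) := by
  set q : ℕ → ℤ := fun n => (cfPQ x n).2 with hqdef
  have hq : ∀ n, 0 < q n := one_le_cfPQ_snd hx
  have hb : ∀ n, 0 ≤ cfb (n + 1) x := fun n => zero_le_one.trans (one_le_cfb_succ hx n)
  set B : ℕ → ℝ := fun n => C * (((q (n + 2) : ℤ) : ℝ) ^ (-k.re) *
    Real.exp (((q (n + 1) : ℝ) / q (n + 2)) ^ (-1 + δ))) with hB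
  have hBsum : Summable B := hsum.mul_left C
  have hterm : ∀ (n : ℕ) (y : ℝ), |y| = (q (n + 1) : ℝ) / q (n + 2) →
      ‖((q (n + 2) : ℝ) : ℂ) ^ (-k) * h y‖ ≤ B n := by
    intro n y hy
    have h1 : (0 : ℝ) < q (n + 1) := mod_cast hq (n + 1)
    have h2 : (0 : ℝ) < q (n + 2) := mod_cast hq (n + 2)
    have hlt : (q (n + 1) : ℝ) < q (n + 2) := mod_cast cfPQ_snd_lt hx n
    have hy0 : 0 < |y| := by rw [hy]; positivity
    have hy1 : |y| < 1 := by rw [hy]; exact (div_lt_one h2).2 hlt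
    have := hbound y (abs_lt.1 hy1) (abs_pos.1 hy0)
    rw [hy] at this
    rw [norm_mul, Complex.norm_cpow_eq_rpow_re_of_pos h2, Complex.neg_re, hB]
    refine (mul_le_mul_of_nonneg_left this (by positivity)).trans_eq ?_
    ring
  set v : ℕ → ℂ := fun j =>
    ((q (2 * j + 1) : ℝ) : ℂ) ^ (-k) * f (q (2 * j) / q (2 * j + 1)) with hv
  have hdist : ∀ j, dist (v j) (v j.succ) ≤ B (2 * j) + B (2 * j + 1) := by
    intro j
    have e1 := cpow_mul_apply_div hper hrec (hq (2 * j + 2)) (hq (2 * j + 1)) (hb (2 * j + 2))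
      (cfPQ_snd_succ_succ x (2 * j + 1))
    have e2 := cpow_mul_apply_neg_div hper hrec (hq (2 * j + 1)) (hq (2 * j)) (hb (2 * j + 1))
      (cfPQ_snd_succ_succ x (2 * j))
    have hstep : v (j + 1) - v j
        = ((q (2 * j + 2) : ℝ) : ℂ) ^ (-k) * h (-((q (2 * j + 1) : ℝ) / q (2 * j + 2)))
          + ((q (2 * j + 1 + 2) : ℝ) : ℂ) ^ (-k)
            * h ((q (2 * j + 1 + 1) : ℝ) / q (2 * j + 1 + 2)) := by
      linear_combination e1 + e2
    have hnn : ∀ n, (0 : ℝ) ≤ (q (n + 1) : ℝ) / q (n + 2) := fun n =>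
      div_nonneg (mod_cast (hq _).le) (mod_cast (hq _).le)
    rw [dist_comm, dist_eq_norm, Nat.succ_eq_add_one, hstep]
    refine (norm_add_le _ _).trans (add_le_add (hterm _ _ ?_) (hterm _ _ ?_))
    · rw [abs_neg, abs_of_nonneg (hnn _)]
    · rw [abs_of_nonneg (hnn _)]
  have hBsum2 : Summable fun j => B (2 * j) + B (2 * j + 1) :=
    (hBsum.comp_injective fun a b hab => by omega).add
      (hBsum.comp_injective fun a b hab => by omega)
  obtain ⟨l, hl⟩ := cauchySeq_tendsto_of_complete
    (cauchySeq_of_dist_le_of_summable _ hdist hBsum2)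
  refine ⟨l, hl.congr' ?_⟩
  filter_upwards [eventually_ne_atTop 0] with j hj
  have hden : ((cfConv x (2 * j + 1)).den : ℝ) = q (2 * j + 1) := mod_cast cfConv_den hx (2 * j)
  rw [hden, ratBar_cfConv hx (even_two_mul j) (by omega)]

/-- For `Re k > 0` and a period function of (at most) mildly exponential
growth at `0`, the limit `f‡(x) = lim_j den(x_{2j+1})^{-k} f((x_{2j+1})‾)` along odd-index
continued fraction convergents exists almost everywhere, and the resulting function is
Lebesgue-measurable. -/
theorem stmt7 (k : ℂ) (hk : 0 < k.re) (δ : ℝ) (hδ : 0 < δ)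
    (f : ℚ → ℂ) (h : ℝ → ℂ)
    (hper : ∀ x : ℚ, x ∉ Set.Icc (-1 : ℚ) 0 → f (x + 1) = f x)
    (hrec : ∀ x : ℚ, x ≠ 0 →
      f x - ((|((x : ℚ) : ℝ)| : ℝ) : ℂ) ^ (-k) * f (-1 / x) = h x)
    (C : ℝ) (hC : 0 < C)
    (hbound : ∀ x : ℝ, x ∈ Set.Ioo (-1 : ℝ) 1 → x ≠ 0 →
      ‖h x‖ ≤ C * Real.exp (|x| ^ (-1 + δ))) :
    ∃ (X : Set ℝ) (F : ℝ → ℂ), volume Xᶜ = 0 ∧ Measurable F ∧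
      ∀ x ∈ X, Tendsto
        (fun j : ℕ => (((cfConv x (2 * j + 1)).den : ℝ) : ℂ) ^ (-k)
          * f (ratBar (cfConv x (2 * j + 1))))
        atTop (nhds (F x)) := by
  obtain ⟨A, hA, hAδ⟩ : ∃ A : ℝ, 1 < A ∧ A * max (1 - δ) (1 / 2) < 1 := by
    have hθ0 : 0 < max (1 - δ) (1 / 2) := lt_max_of_lt_right (by norm_num)
    have hθ1 : max (1 - δ) (1 / 2) < 1 := max_lt (by linarith) (by norm_num)
    obtain ⟨A, hA, hA'⟩ := exists_between ((one_lt_inv₀ hθ0).2 hθ1)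
    exact ⟨A, hA, (lt_div_iff₀ hθ0).1 (by rwa [one_div])⟩
  have hmeas : ∀ j : ℕ, AEMeasurable (fun x : ℝ =>
      (((cfConv x (2 * j + 1)).den : ℝ) : ℂ) ^ (-k) * f (ratBar (cfConv x (2 * j + 1)))) volume :=
    fun j => ((Measurable.of_discrete (f := fun p : ℤ × ℤ =>
      ((((p.1 / p.2 : ℚ)).den : ℝ) : ℂ) ^ (-k) * f (ratBar (p.1 / p.2 : ℚ)))).comp
        (measurable_cfPQ (2 * j + 1))).aemeasurable
  have hirr : ∀ᵐ x : ℝ, Irrational x := (countable_range ((↑) : ℚ → ℝ)).ae_notMem _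
  obtain ⟨F, hF, hlim⟩ := measurable_limit_of_tendsto_metrizable_ae (L := atTop) hmeas (by
    filter_upwards [hirr, ae_eventually_cfb_le hA] with x hx hxA
    exact exists_tendsto_of_summable hper hrec hbound hx
      (summable_cfPQ_rpow_mul_exp hx hxA (by linarith) hk hAδ))
  exact ⟨_, F, hlim, hF, fun x hx => hx⟩
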